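/- Let k ≥ 2, r ≥ 3, n ≥ (k+1)r + 1, and let 𝒜 ⊆ [n]^(r)_k be an intersecting family of k-separated r-subsets of [n] with |𝒜| = binomial(n−kr−1, r−1) and {A ∈ [n]^(r)_k : 1 ∈ A and k+2 ∈ A} ⊆ 𝒜. Then (i) every set in 𝒜 has nonempty intersection with {1, k+2}; and (ii) for every A = {1, a_2, ..., a_r} ∈ [n]^(r)_k with A ∩ {1, k+2} = {1}, exactly one of the two sets A and g(A) = {k+2, a_2 + k, ..., a_r + k} belongs to 𝒜. -/

import Mathlib

/-- The family of all `k`-separated `r`-subsets of `[n] = {1,…,n}`: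
`A = {a₁ < … < a_r} ⊆ [n]` with consecutive circular gaps all `> k`.
Equivalently (for nonempty `A`): `k < n` and every pair `a < b` in `A`
satisfies `b - a > k` and `(a + n) - b > k`. -/
def sepSets (n k r : ℕ) : Finset (Finset ℕ) :=
  (Finset.Icc 1 n).powerset.filter fun A =>
    A.card = r ∧ k < n ∧ ∀ a ∈ A, ∀ b ∈ A, a < b → k < b - a ∧ b - a + k < n

/-- A family of sets is intersecting if any two members meet. -/
def Intersecting (𝒜 : Finset (Finset ℕ)) : Prop :=
  ∀ A ∈ 𝒜, ∀ B ∈ 𝒜, (A ∩ B).Nonempty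

/-- Linear gaps all exceed `k`. -/
def Gapped (k : ℕ) (A : Finset ℕ) : Prop := ∀ a ∈ A, ∀ b ∈ A, a < b → k < b - a

theorem block_count (k : ℕ) (A : Finset ℕ) (hA : Gapped k A) (u t : ℕ) :
    (A.filter fun a => u ≤ a ∧ a < u + t * (k + 1)).card ≤ t := by
  induction t with
  | zero =>
    rw [Finset.card_eq_zero.mpr]
    ext a
    simp
  | succ t ih =>
    have h1 : (A.filter fun a => u ≤ a ∧ a < u + (t + 1) * (k + 1)) ⊆
        (A.filter fun a => u ≤ a ∧ a < u + t * (k + 1)) ∪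
        (A.filter fun a => u + t * (k + 1) ≤ a ∧ a < u + (t + 1) * (k + 1)) := by
      intro a
      simp only [Finset.mem_union, Finset.mem_filter]
      intro h
      rcases lt_or_ge a (u + t * (k + 1)) with h' | h'
      · exact Or.inl ⟨h.1, h.2.1, h'⟩
      · exact Or.inr ⟨h.1, h', h.2.2⟩
    have h2 : (A.filter fun a => u + t * (k + 1) ≤ a ∧ a < u + (t + 1) * (k + 1)).card ≤ 1 := by
      rw [Finset.card_le_one]
      intro a ha b hb
      simp only [Finset.mem_filter] at ha hb
      have e : (t + 1) * (k + 1) = t * (k + 1) + (k + 1) := by ring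
      rcases lt_trichotomy a b with h | h | h
      · have := hA a ha.1 b hb.1 h
        omega
      · exact h
      · have := hA b hb.1 a ha.1 h
        omega
    have h3 := Finset.card_le_card h1
    have h4 := Finset.card_union_le
      (A.filter fun a => u ≤ a ∧ a < u + t * (k + 1))
      (A.filter fun a => u + t * (k + 1) ≤ a ∧ a < u + (t + 1) * (k + 1))
    omega

/-- The greedy choice of a gapped set avoiding `A`, or a certificate of failure. -/
theorem greedy (k : ℕ) (hk : 1 ≤ k) (A : Finset ℕ) (hA : Gapped k A) (m : ℕ) :
    ∀ q s : ℕ, (∃ B : Finset ℕ, B.card = m ∧ Gapped k B ∧ Disjoint A B ∧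
        ∀ b ∈ B, q ≤ b ∧ b + (k + 1) ≤ q + m * (k + 1) + s) ∨
      ∃ i j : ℕ, i ≤ j ∧ j < m ∧ q + i * (k + 1) ∈ A ∧ q + j * (k + 1) + s ∈ A ∧
        (A.filter fun a => q + i * (k + 1) ≤ a ∧ a < q + j * (k + 1) + s).card ≤ j - i := by
  induction m with
  | zero =>
    intro q s
    left
    exact ⟨∅, by simp, by simp [Gapped], by simp, by simp⟩
  | succ m ih =>
    intro q s
    have em : (m + 1) * (k + 1) = m * (k + 1) + (k + 1) := by ring
    by_cases hq : q ∈ A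
    · rcases Nat.eq_zero_or_pos s with hs | hs
      · right
        refine ⟨0, 0, le_refl _, by omega, by simpa using hq, by simpa [hs] using hq, ?_⟩
        rw [Finset.card_eq_zero.mpr]
        ext a
        simp
        omega
      · have hq1 : q + 1 ∉ A := fun h => by
          have := hA q hq (q + 1) h (by omega)
          omega
        rcases ih (q + 1 + (k + 1)) (s - 1) with ⟨B, h1, h2, h3, h4⟩ | ⟨i, j, hij, hjm, hx, hy, hc⟩
        · left
          have hnot : q + 1 ∉ B := fun h => by
            have := h4 _ h
            omega
          refine ⟨insert (q + 1) B, by rw [Finset.card_insert_of_notMem hnot, h1], ?_, ?_, ?_⟩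
          · intro a ha b hb hab
            rw [Finset.mem_insert] at ha hb
            rcases ha with rfl | ha <;> rcases hb with rfl | hb
            · omega
            · have := h4 _ hb
              omega
            · have := h4 _ ha
              omega
            · exact h2 a ha b hb hab
          · rw [Finset.disjoint_insert_right]
            exact ⟨hq1, h3⟩
          · intro b hb
            rw [Finset.mem_insert] at hb
            rcases hb with rfl | hb
            · omega
            · have := h4 _ hb
              omega
        · right
          have ei : (i + 1) * (k + 1) = i * (k + 1) + (k + 1) := by ring
          have ej : (j + 1) * (k + 1) = j * (k + 1) + (k + 1) := by ring
          have hle : i * (k + 1) ≤ j * (k + 1) := Nat.mul_le_mul_right _ hij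
          refine ⟨0, j + 1, by omega, by omega, by simpa using hq, ?_, ?_⟩
          · convert hy using 1
            omega
          · have hb := block_count k A hA q (i + 1)
            have hsub : (A.filter fun a => q + 0 * (k + 1) ≤ a ∧ a < q + (j + 1) * (k + 1) + s) ⊆
                (A.filter fun a => q ≤ a ∧ a < q + (i + 1) * (k + 1)) ∪
                (A.filter fun a => q + 1 + (k + 1) + i * (k + 1) ≤ a ∧
                  a < q + 1 + (k + 1) + j * (k + 1) + (s - 1)) := by
              intro a
              simp only [Finset.mem_union, Finset.mem_filter]
              rintro ⟨ha, h5, h6⟩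
              have hne : a + 1 ≠ q + 1 + (k + 1) + i * (k + 1) := by
                intro h
                have := hA a ha _ hx (by omega)
                omega
              rcases lt_or_ge a (q + (i + 1) * (k + 1)) with h' | h'
              · exact Or.inl ⟨ha, by omega, h'⟩
              · exact Or.inr ⟨ha, by omega, by omega⟩
            have h7 := Finset.card_le_card hsub
            have h8 := Finset.card_union_le
                (A.filter fun a => q ≤ a ∧ a < q + (i + 1) * (k + 1))
                (A.filter fun a => q + 1 + (k + 1) + i * (k + 1) ≤ a ∧
                  a < q + 1 + (k + 1) + j * (k + 1) + (s - 1))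
            omega
    · rcases ih (q + (k + 1)) s with ⟨B, h1, h2, h3, h4⟩ | ⟨i, j, hij, hjm, hx, hy, hc⟩
      · left
        have hnot : q ∉ B := fun h => by
          have := h4 _ h
          omega
        refine ⟨insert q B, by rw [Finset.card_insert_of_notMem hnot, h1], ?_, ?_, ?_⟩
        · intro a ha b hb hab
          rw [Finset.mem_insert] at ha hb
          rcases ha with rfl | ha <;> rcases hb with rfl | hb
          · omega
          · have := h4 _ hb
            omega
          · have := h4 _ ha
            omega
          · exact h2 a ha b hb hab
        · rw [Finset.disjoint_insert_right]
          exact ⟨hq, h3⟩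
        · intro b hb
          rw [Finset.mem_insert] at hb
          rcases hb with rfl | hb
          · omega
          · have := h4 _ hb
            omega
      · right
        have ei : q + (i + 1) * (k + 1) = q + (k + 1) + i * (k + 1) := by ring
        have ej : q + (j + 1) * (k + 1) = q + (k + 1) + j * (k + 1) := by ring
        refine ⟨i + 1, j + 1, by omega, by omega, ?_, ?_, ?_⟩
        · rw [ei]
          exact hx
        · rw [ej]
          exact hy
        · rw [ei, ej]
          omega

theorem mem_sep {n k r : ℕ} {A : Finset ℕ} : A ∈ sepSets n k r ↔
    (∀ a ∈ A, 1 ≤ a ∧ a ≤ n) ∧ A.card = r ∧ k < n ∧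
      ∀ a ∈ A, ∀ b ∈ A, a < b → k < b - a ∧ b - a + k < n := by
  simp only [sepSets, Finset.mem_filter, Finset.mem_powerset, Finset.subset_iff, Finset.mem_Icc]

/-- A separated set missing `1` and `k+2` is disjoint from some separated set containing both. -/
theorem exists_disjoint (n k r : ℕ) (hk : 2 ≤ k) (hr : 3 ≤ r) (hn : (k + 1) * r + 1 ≤ n)
    (A : Finset ℕ) (hA : A ∈ sepSets n k r) (h1 : 1 ∉ A) (h2 : k + 2 ∉ A) :
    ∃ B ∈ sepSets n k r, 1 ∈ B ∧ k + 2 ∈ B ∧ Disjoint A B := by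
  rw [mem_sep] at hA
  obtain ⟨hAr, hAc, hkn, hAg⟩ := hA
  have hG : Gapped k A := fun a ha b hb hab => (hAg a ha b hb hab).1
  obtain ⟨m, rfl⟩ : ∃ m, r = m + 2 := ⟨r - 2, by omega⟩
  have er : (k + 1) * (m + 2) = m * (k + 1) + 2 * k + 2 := by ring
  rcases greedy k (by omega) A hG m (2 * k + 3) (n - (k + 1) * (m + 2)) with
    ⟨B, hBc, hBg, hBd, hBr⟩ | ⟨i, j, hij, hjm, hx, hy, hc⟩
  · have hB' : ∀ b ∈ B, 2 * k + 3 ≤ b ∧ b + k ≤ n := fun b hb => by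
      have := hBr b hb
      omega
    have n1 : k + 2 ∉ B := fun h => by
      have := hB' _ h
      omega
    have n2 : 1 ∉ insert (k + 2) B := fun h => by
      rw [Finset.mem_insert] at h
      rcases h with h | h
      · omega
      · have := hB' _ h
        omega
    refine ⟨insert 1 (insert (k + 2) B), ?_, by simp, by simp, ?_⟩
    · rw [mem_sep]
      refine ⟨?_, ?_, hkn, ?_⟩
      · intro a ha
        simp only [Finset.mem_insert] at ha
        rcases ha with rfl | rfl | ha
        · omega
        · omega
        · have := hB' _ ha
          omega
      · rw [Finset.card_insert_of_notMem n2, Finset.card_insert_of_notMem n1, hBc]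
      · intro a ha b hb hab
        simp only [Finset.mem_insert] at ha hb
        have fa : a ∈ B → 2 * k + 3 ≤ a ∧ a + k ≤ n := hB' a
        have fb : b ∈ B → 2 * k + 3 ≤ b ∧ b + k ≤ n := hB' b
        have fab : a ∈ B → b ∈ B → k < b - a := fun p q => hBg a p b q hab
        have hm : k + 1 ≤ m * (k + 1) := Nat.le_mul_of_pos_left _ (by omega)
        rcases ha with ha | ha | ha <;> rcases hb with hb | hb | hb
        · omega
        · omega
        · have := fb hb
          omega
        · omega
        · omega
        · have := fb hb
          omega
        · have := fa ha
          omega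
        · have := fa ha
          omega
        · have := fa ha
          have := fb hb
          have := fab ha hb
          omega
    · rw [Finset.disjoint_insert_right, Finset.disjoint_insert_right]
      exact ⟨h1, h2, hBd⟩
  · exfalso
    have hle : i * (k + 1) ≤ j * (k + 1) := Nat.mul_le_mul_right _ hij
    have b1 := block_count k A hG 2 (i + 1)
    obtain ⟨d, rfl⟩ : ∃ d, m = j + d := ⟨m - j, by omega⟩
    have b2 := block_count k A hG (2 * k + 3 + j * (k + 1) + (n - (k + 1) * (j + d + 2))) d
    have e1 : (i + 1) * (k + 1) = i * (k + 1) + (k + 1) := by ring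
    have e2 : (j + d) * (k + 1) = j * (k + 1) + d * (k + 1) := by ring
    set s := n - (k + 1) * (j + d + 2) with hs
    have hsub : A ⊆ ((A.filter fun a => 2 ≤ a ∧ a < 2 + (i + 1) * (k + 1)) ∪
        (A.filter fun a => 2 * k + 3 + i * (k + 1) ≤ a ∧ a < 2 * k + 3 + j * (k + 1) + s)) ∪
        (A.filter fun a => 2 * k + 3 + j * (k + 1) + s ≤ a ∧
          a < 2 * k + 3 + j * (k + 1) + s + d * (k + 1)) := by
      intro a ha
      simp only [Finset.mem_union, Finset.mem_filter]
      have hr := hAr a ha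
      have hne : a ≠ 1 := fun h => h1 (h ▸ ha)
      have hg : a < 2 * k + 3 + i * (k + 1) → k < 2 * k + 3 + i * (k + 1) - a :=
        fun h => hG a ha _ hx h
      rcases lt_or_ge a (2 * k + 3 + i * (k + 1)) with h | h
      · have := hg h
        exact Or.inl (Or.inl ⟨ha, by omega, by omega⟩)
      · rcases lt_or_ge a (2 * k + 3 + j * (k + 1) + s) with h' | h'
        · exact Or.inl (Or.inr ⟨ha, h, h'⟩)
        · exact Or.inr ⟨ha, h', by omega⟩
    have c1 := Finset.card_le_card hsub
    have c2 := c1.trans (Finset.card_union_le _ _)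
    have c3 := c2.trans (Nat.add_le_add_right (Finset.card_union_le _ _) _)
    omega

/-- Gapped `m`-subsets of `{0,…,l-1}`. -/
noncomputable def gapFam (k l m : ℕ) : Finset (Finset ℕ) :=
  @Finset.filter _ (Gapped k) (Classical.decPred _) ((Finset.range l).powersetCard m)

theorem gapFam_card (k m l : ℕ) : (gapFam k l m).card ≤ (l + k - k * m).choose m := by
  induction l using Nat.strong_induction_on generalizing m with
  | _ l ih =>
  rcases m with _ | m
  · refine (Finset.card_le_card (@Finset.filter_subset _ _ (Classical.decPred _) _)).trans ?_
    simp
  rcases l with _ | l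
  · rw [Finset.card_eq_zero.mpr]
    · omega
    · ext S
      simp [gapFam, Finset.mem_powersetCard]
      rintro rfl
      simp
  have hsub : gapFam k (l + 1) (m + 1) ⊆
      gapFam k l (m + 1) ∪ (gapFam k (l - k) m).image (insert l) := by
    intro S hS
    simp only [gapFam, Finset.mem_union, Finset.mem_image, Finset.mem_filter,
      Finset.mem_powersetCard] at hS ⊢
    obtain ⟨⟨h1, h2⟩, h3⟩ := hS
    by_cases hl : l ∈ S
    · right
      refine ⟨S.erase l, ⟨⟨?_, ?_⟩, ?_⟩, Finset.insert_erase hl⟩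
      · intro a ha
        rw [Finset.mem_erase] at ha
        have := h1 ha.2
        rw [Finset.mem_range] at this ⊢
        have := h3 a ha.2 l hl (by omega)
        omega
      · rw [Finset.card_erase_of_mem hl]
        omega
      · intro a ha b hb
        exact h3 a (Finset.mem_of_mem_erase ha) b (Finset.mem_of_mem_erase hb)
    · left
      refine ⟨⟨?_, h2⟩, h3⟩
      intro a ha
      have := h1 ha
      have hne : a ≠ l := fun h => hl (h ▸ ha)
      rw [Finset.mem_range] at this ⊢
      omega
  have c1 := (Finset.card_le_card hsub).trans (Finset.card_union_le _ _)
  have c2 : ((gapFam k (l - k) m).image (insert l)).card ≤ _ := Finset.card_image_le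
  have i1 := ih l (by omega) (m + 1)
  have i2 := ih (l - k) (by omega) m
  have e : k * (m + 1) = k * m + k := by ring
  rw [e] at i1 ⊢
  rcases Nat.lt_or_ge l (k * m) with h | h
  · have hm : 1 ≤ m := by
      by_contra hh
      have : m = 0 := by omega
      subst this
      omega
    have hkm : k ≤ k * m := Nat.le_mul_of_pos_right _ hm
    have z1 : (l + k - (k * m + k)).choose (m + 1) = 0 :=
      Nat.choose_eq_zero_of_lt (by omega)
    have z2 : (l - k + k - k * m).choose m = 0 :=
      Nat.choose_eq_zero_of_lt (by omega)
    omega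
  · have z3 : (l - k + k - k * m).choose m ≤ (l - k * m).choose m := by
      rcases Nat.eq_zero_or_pos m with rfl | hm
      · simp
      · have hkm : k ≤ k * m := Nat.le_mul_of_pos_right _ hm
        apply Nat.choose_le_choose
        omega
    have z4 : l + k - (k * m + k) = l - k * m := by omega
    have z5 : l + 1 + k - (k * m + k) = l - k * m + 1 := by omega
    rw [z4] at i1
    rw [z5, Nat.choose_succ_succ']
    omega

theorem star_card (n k r : ℕ) (hr : 3 ≤ r) (hn : (k + 1) * r + 1 ≤ n) :
    ((sepSets n k r).filter fun A => 1 ∈ A).card ≤ (n - k * r - 1).choose (r - 1) := by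
  have hsub : ((sepSets n k r).filter fun A => 1 ∈ A) ⊆
      (gapFam k (n - 2 * k - 1) (r - 1)).image
        (fun S => insert 1 (S.image fun a => a + (k + 2))) := by
    intro A hA
    rw [Finset.mem_filter, mem_sep] at hA
    obtain ⟨⟨h1, h2, h3, h4⟩, h5⟩ := hA
    have hr : ∀ a ∈ A.erase 1, k + 2 ≤ a ∧ a + k ≤ n := by
      intro a ha
      rw [Finset.mem_erase] at ha
      have := h1 a ha.2
      have := h4 1 h5 a ha.2 (by omega)
      omega
    simp only [gapFam, Finset.mem_image, Finset.mem_filter, Finset.mem_powersetCard]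
    refine ⟨(A.erase 1).image fun a => a - (k + 2), ⟨⟨?_, ?_⟩, ?_⟩, ?_⟩
    · intro b hb
      rw [Finset.mem_image] at hb
      obtain ⟨a, ha, rfl⟩ := hb
      have := hr a ha
      rw [Finset.mem_range]
      omega
    · rw [Finset.card_image_of_injOn, Finset.card_erase_of_mem h5, h2]
      intro a ha b hb hab
      have := hr a ha
      have := hr b hb
      simp only at hab
      omega
    · intro x hx y hy hxy
      rw [Finset.mem_image] at hx hy
      obtain ⟨a, ha, rfl⟩ := hx
      obtain ⟨b, hb, rfl⟩ := hy
      have := hr a ha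
      have := hr b hb
      have := h4 a (Finset.mem_of_mem_erase ha) b (Finset.mem_of_mem_erase hb) (by omega)
      omega
    · rw [Finset.image_image]
      conv_rhs => rw [← Finset.insert_erase h5]
      congr 1
      conv_rhs => rw [← Finset.image_id (s := A.erase 1)]
      apply Finset.image_congr
      intro a ha
      have := hr a ha
      simp only [Function.comp, id]
      omega
  refine (Finset.card_le_card hsub).trans (Finset.card_image_le.trans
    ((gapFam_card _ _ _).trans ?_))
  obtain ⟨m, rfl⟩ : ∃ m, r = m + 1 := ⟨r - 1, by omega⟩
  have e1 : k * (m + 1) = k * m + k := by ring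
  have e2 : (k + 1) * (m + 1) = k * m + k + m + 1 := by ring
  have hkm : k ≤ k * m := Nat.le_mul_of_pos_right _ (by omega)
  apply Nat.choose_le_choose
  rw [e1]
  simp only [Nat.add_sub_cancel]
  omega

theorem stmt17 (n k r : ℕ) (hk : 2 ≤ k) (hr : 3 ≤ r) (hn : (k + 1) * r + 1 ≤ n)
    (𝒜 : Finset (Finset ℕ)) (h𝒜 : 𝒜 ⊆ sepSets n k r) (hint : Intersecting 𝒜)
    (hcard : 𝒜.card = (n - k * r - 1).choose (r - 1))
    (hsub : ((sepSets n k r).filter fun A => 1 ∈ A ∧ k + 2 ∈ A) ⊆ 𝒜) :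
    (∀ A ∈ 𝒜, (A ∩ ({1, k + 2} : Finset ℕ)).Nonempty) ∧
      ∀ A ∈ sepSets n k r, A ∩ ({1, k + 2} : Finset ℕ) = {1} →
        Xor' (A ∈ 𝒜) ((A.image fun a => if a = 1 then k + 2 else a + k) ∈ 𝒜) := by
  have hi : ∀ A ∈ 𝒜, 1 ∈ A ∨ k + 2 ∈ A := by
    intro A hA
    by_contra hcon
    push Not at hcon
    obtain ⟨B, hB, h1, h2, hd⟩ := exists_disjoint n k r hk hr hn A (h𝒜 hA) hcon.1 hcon.2
    have hB' : B ∈ 𝒜 := hsub (Finset.mem_filter.mpr ⟨hB, h1, h2⟩)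
    have := hint A hA B hB'
    rw [Finset.disjoint_iff_inter_eq_empty.mp hd] at this
    simp at this
  -- a set with `1` but without `k+2` is disjoint from its image
  have hnb : ∀ A ∈ sepSets n k r, 1 ∈ A → k + 2 ∉ A → A ∈ 𝒜 →
      (A.image fun a => if a = 1 then k + 2 else a + k) ∈ 𝒜 → False := by
    intro A hA h1 h2 hA1 hA2
    obtain ⟨x, hx⟩ := hint _ hA1 _ hA2
    rw [Finset.mem_inter, Finset.mem_image] at hx
    obtain ⟨hx, a, ha, hax⟩ := hx
    rw [mem_sep] at hA
    split_ifs at hax with h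
    · exact h2 (hax ▸ hx)
    · have := (hA.2.2.2 a ha x hx (by omega)).1
      omega
  refine ⟨?_, ?_⟩
  · intro A hA
    rcases hi A hA with h | h
    · exact ⟨1, by simp [h]⟩
    · exact ⟨k + 2, by simp [h]⟩
  · intro A hA hA1
    have m1 : 1 ∈ A := by
      have : 1 ∈ A ∩ ({1, k + 2} : Finset ℕ) := by simp [hA1]
      exact Finset.mem_of_mem_inter_left this
    have m2 : k + 2 ∉ A := by
      intro h
      have : k + 2 ∈ A ∩ ({1, k + 2} : Finset ℕ) := by simp [h]
      rw [hA1, Finset.mem_singleton] at this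
      omega
    by_cases hx : A ∈ 𝒜
    · exact Or.inl ⟨hx, fun h => hnb A hA m1 m2 hx h⟩
    by_cases hy : (A.image fun a => if a = 1 then k + 2 else a + k) ∈ 𝒜
    · exact Or.inr ⟨hy, hx⟩
    exfalso
    set S := (sepSets n k r).filter fun A => 1 ∈ A with hS
    have hcov : 𝒜 ⊆ (S ∩ 𝒜) ∪
        ((S \ 𝒜).erase A).image (fun A => A.image fun a => if a = 1 then k + 2 else a + k) := by
      intro B hB
      have hBs := h𝒜 hB
      rw [Finset.mem_union]
      by_cases b1 : 1 ∈ B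
      · left
        rw [Finset.mem_inter, hS, Finset.mem_filter]
        exact ⟨⟨hBs, b1⟩, hB⟩
      right
      have b2 : k + 2 ∈ B := (hi B hB).resolve_left b1
      rw [mem_sep] at hBs
      obtain ⟨g1, g2, g3, g4⟩ := hBs
      have hr : ∀ b ∈ B, b ≠ k + 2 → 2 * k + 3 ≤ b ∧ b ≤ n := by
        intro b hb hne
        have hb1 := g1 b hb
        have hne1 : b ≠ 1 := fun h => b1 (h ▸ hb)
        rcases lt_or_gt_of_ne hne with h | h
        · have := g4 b hb _ b2 h
          omega
        · have := g4 _ b2 b hb h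
          omega
      set C := B.image fun b => if b = k + 2 then 1 else b - k with hC
      have hCB : (C.image fun a => if a = 1 then k + 2 else a + k) = B := by
        rw [hC, Finset.image_image]
        conv_rhs => rw [← Finset.image_id (s := B)]
        apply Finset.image_congr
        intro b hb
        simp only [Function.comp, id]
        by_cases h : b = k + 2
        · simp [h]
        · have := hr b hb h
          rw [if_neg h, if_neg (by omega)]
          omega
      have c1 : 1 ∈ C := by
        rw [hC, Finset.mem_image]
        exact ⟨k + 2, b2, by simp⟩
      have c2 : k + 2 ∉ C := by
        intro h
        rw [hC, Finset.mem_image] at h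
        obtain ⟨b, hb, h⟩ := h
        split_ifs at h with h'
        · omega
        · have := hr b hb h'
          omega
      have hCs : C ∈ sepSets n k r := by
        rw [mem_sep]
        refine ⟨?_, ?_, g3, ?_⟩
        · intro c hc
          rw [hC, Finset.mem_image] at hc
          obtain ⟨b, hb, rfl⟩ := hc
          split_ifs with h
          · omega
          · have := hr b hb h
            omega
        · rw [hC, Finset.card_image_of_injOn, g2]
          intro a ha b hb hab
          have := hr a ha
          have := hr b hb
          simp only at hab
          split_ifs at hab <;> omega
        · intro x hx y hy hxy
          rw [hC, Finset.mem_image] at hx hy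
          obtain ⟨a, ha, rfl⟩ := hx
          obtain ⟨b, hb, rfl⟩ := hy
          have := hr a ha
          have := hr b hb
          have := g4 a ha b hb
          split_ifs at hxy ⊢ <;> omega
      rw [Finset.mem_image]
      refine ⟨C, ?_, hCB⟩
      rw [Finset.mem_erase, Finset.mem_sdiff, hS, Finset.mem_filter]
      refine ⟨?_, ⟨hCs, c1⟩, ?_⟩
      · intro h
        apply hy
        rw [← h, hCB]
        exact hB
      · intro h
        exact hnb C hCs c1 c2 h (hCB.symm ▸ hB)
    have k1 := (Finset.card_le_card hcov).trans (Finset.card_union_le _ _)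
    have k2 := k1.trans (Nat.add_le_add_left Finset.card_image_le _)
    have hmem : A ∈ S \ 𝒜 := by
      rw [Finset.mem_sdiff, hS, Finset.mem_filter]
      exact ⟨⟨hA, m1⟩, hx⟩
    rw [Finset.card_erase_of_mem hmem] at k2
    have k3 : 0 < (S \ 𝒜).card := Finset.card_pos.mpr ⟨A, hmem⟩
    have k4 := Finset.card_inter_add_card_sdiff S 𝒜
    have k5 := star_card n k r hr hn
    rw [← hS] at k5
    omega
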